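/- Let K = 2, w = (1,1), and u(x,y) = max(2x,y) on B = [0,1]^2. Define v̄(p,q,m) = max{u(x,y) : (x,y) ∈ B, px + qy ≤ m} for p,q > 0 and m ≥ 0, and the quasiconcavification ū(x,y) = inf{v̄(p,q, px+qy) : p,q > 0} for (x,y) ∈ B. Then for all (x,y) ∈ [0,1]^2, ū(x,y) = max(min(2x + y, 1), 2x), and for all p,q > 0 and m ≥ 0, v̄(p,q,m) = max(2·min(1, m/p), min(1, m/q)). -/

import Mathlib

/-- `vbar` is the restricted-domain indirect utility of `u(x,y) = max(2x,y)` on the box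
`B = [0,1]²`: `vbar p q m = max {max(2x,y) : (x,y) ∈ B, px + qy ≤ m}`. -/
def IsBoxIndirectUtilityMax (vbar : ℝ → ℝ → ℝ → ℝ) : Prop :=
  ∀ p q m : ℝ, 0 < p → 0 < q → 0 ≤ m →
    IsGreatest {t | ∃ x y : ℝ, 0 ≤ x ∧ x ≤ 1 ∧ 0 ≤ y ∧ y ≤ 1 ∧
      p * x + q * y ≤ m ∧ max (2 * x) y = t} (vbar p q m)

/-- The quasiconcavification `ū(x,y) = inf {vbar p q (px + qy) : p, q > 0}`. -/
noncomputable def ubar (vbar : ℝ → ℝ → ℝ → ℝ) (x y : ℝ) : ℝ :=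
  sInf {t | ∃ p q : ℝ, 0 < p ∧ 0 < q ∧ vbar p q (p * x + q * y) = t}

/-- The explicit form of the restricted-domain indirect utility. -/
theorem IsBoxIndirectUtilityMax.eq_max {vbar : ℝ → ℝ → ℝ → ℝ}
    (hvbar : IsBoxIndirectUtilityMax vbar) {p q m : ℝ} (hp : 0 < p) (hq : 0 < q) (hm : 0 ≤ m) :
    vbar p q m = max (2 * min 1 (m / p)) (min 1 (m / q)) := by
  refine (hvbar p q m hp hq hm).unique ⟨?_, ?_⟩
  · have hx : 0 ≤ min 1 (m / p) := le_min zero_le_one (div_nonneg hm hp.le)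
    have hy : 0 ≤ min 1 (m / q) := le_min zero_le_one (div_nonneg hm hq.le)
    rcases le_total (min 1 (m / q)) (2 * min 1 (m / p)) with h | h
    · refine ⟨min 1 (m / p), 0, hx, min_le_left _ _, le_rfl, zero_le_one, ?_, ?_⟩
      · have := (le_div_iff₀ hp).1 (min_le_right 1 (m / p))
        linarith
      · rw [max_eq_left h, max_eq_left (by linarith)]
    · refine ⟨0, min 1 (m / q), le_rfl, zero_le_one, hy, min_le_left _ _, ?_, ?_⟩
      · have := (le_div_iff₀ hq).1 (min_le_right 1 (m / q))
        linarith
      · rw [max_eq_right h, max_eq_right (by linarith)]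
  · rintro t ⟨x, y, hx0, hx1, hy0, hy1, hxy, rfl⟩
    have hpx := mul_nonneg hp.le hx0
    have hqy := mul_nonneg hq.le hy0
    have hx : x ≤ min 1 (m / p) := le_min hx1 ((le_div_iff₀ hp).2 (by linarith))
    have hy : y ≤ min 1 (m / q) := le_min hy1 ((le_div_iff₀ hq).2 (by linarith))
    exact max_le_max (by linarith) hy

/-- At every positive price, the indirect utility of the value of a bundle in the box is at least
the claimed quasiconcavification. -/
theorem IsBoxIndirectUtilityMax.le_apply {vbar : ℝ → ℝ → ℝ → ℝ}
    (hvbar : IsBoxIndirectUtilityMax vbar) {p q x y : ℝ} (hp : 0 < p) (hq : 0 < q)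
    (hx0 : 0 ≤ x) (hx1 : x ≤ 1) (hy0 : 0 ≤ y) :
    max (min (2 * x + y) 1) (2 * x) ≤ vbar p q (p * x + q * y) := by
  have hqy := mul_nonneg hq.le hy0
  rw [hvbar.eq_max hp hq (add_nonneg (mul_nonneg hp.le hx0) hqy)]
  refine max_le ?_ ?_
  · rcases le_total p (2 * q) with h | h
    · refine le_max_of_le_left ?_
      have h1 : (2 * x + y) / 2 ≤ (p * x + q * y) / p := by
        rw [le_div_iff₀ hp]
        nlinarith [mul_le_mul_of_nonneg_right h hy0]
      rcases min_choice 1 ((p * x + q * y) / p) with h2 | h2 <;> rw [h2]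
      · linarith [min_le_right (2 * x + y) 1]
      · linarith [min_le_left (2 * x + y) 1]
    · refine le_max_of_le_right ?_
      have h1 : 2 * x + y ≤ (p * x + q * y) / q := by
        rw [le_div_iff₀ hq]
        nlinarith [mul_le_mul_of_nonneg_right h hx0]
      rw [min_comm]
      exact min_le_min_left 1 h1
  · have h1 : x ≤ min 1 ((p * x + q * y) / p) :=
      le_min hx1 ((le_div_iff₀ hp).2 (by linarith))
    exact le_max_of_le_left (by linarith)

/-- Example 4: for `u(x,y) = max(2x,y)` on `[0,1]²`, the
quasiconcavification is `ū(x,y) = max(min(2x + y, 1), 2x)` and the restricted-domain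
indirect utility is `v̄(p,q,m) = max(2·min(1, m/p), min(1, m/q))`. -/
theorem quasiconcavification_of_max_utility
    (vbar : ℝ → ℝ → ℝ → ℝ) (hvbar : IsBoxIndirectUtilityMax vbar) :
    (∀ x y : ℝ, 0 ≤ x → x ≤ 1 → 0 ≤ y → y ≤ 1 →
      ubar vbar x y = max (min (2 * x + y) 1) (2 * x)) ∧
    (∀ p q m : ℝ, 0 < p → 0 < q → 0 ≤ m →
      vbar p q m = max (2 * min 1 (m / p)) (min 1 (m / q))) := by
  refine ⟨fun x y hx0 hx1 hy0 hy1 => ?_, fun p q m hp hq hm => hvbar.eq_max hp hq hm⟩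
  have hlow : max (min (2 * x + y) 1) (2 * x) ∈
      lowerBounds {t | ∃ p q : ℝ, 0 < p ∧ 0 < q ∧ vbar p q (p * x + q * y) = t} := by
    rintro t ⟨p, q, hp, hq, rfl⟩
    exact hvbar.le_apply hp hq hx0 hx1 hy0
  refine le_antisymm ?_ (le_csInf ⟨_, 1, 1, one_pos, one_pos, rfl⟩ hlow)
  have hinf (k : ℝ) (hk : 0 < k) :
      ubar vbar x y ≤ max (2 * min 1 (x + k * y)) (min 1 ((x + k * y) / k)) := by
    refine csInf_le ⟨_, hlow⟩ ⟨1, k, one_pos, hk, ?_⟩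
    rw [hvbar.eq_max one_pos hk (by positivity), div_one, one_mul]
  rcases le_total (2 * x + y) 1 with h | h
  · rw [min_eq_left h]
    refine (hinf (1 / 2) (by norm_num)).trans (le_max_of_le_left (max_le ?_ ?_))
    · linarith [min_le_right 1 (x + 1 / 2 * y)]
    · exact (min_le_right _ _).trans (by linarith)
  · rw [min_eq_right h]
    refine le_of_forall_pos_le_add fun ε hε => (hinf (ε / 2) (by positivity)).trans (max_le ?_ ?_)
    · have h1 : ε * y ≤ ε := mul_le_of_le_one_right hε.le hy1
      linarith [min_le_right 1 (x + ε / 2 * y), le_max_right 1 (2 * x)]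
    · linarith [min_le_left 1 ((x + ε / 2 * y) / (ε / 2)), le_max_left 1 (2 * x)]
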